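/- arXiv:1104.2913 — 4 statements merged into one kernel-verified Lean document; each statement's English description precedes it below -/
import Mathlib

section
/- Let Γ be a group, H a real inner product space, π an orthogonal representation of Γ on H, and b : Γ → H a cocycle for π. Let Γ₀ be a subgroup of Γ and suppose there exist elements g₁, …, gₙ ∈ Γ₀ such that ‖ξ‖ ≤ ∑_{i=1}^{n} ‖π(gᵢ)ξ − ξ‖ for every ξ ∈ H. Then every h in the centralizer of Γ₀ in Γ satisfies ‖b(h)‖ ≤ 2 ∑_{i=1}^{n} ‖b(gᵢ)‖; in particular, the restriction of b to the centralizer of Γ₀ is bounded. (This is Lemma 2.5(1) of the paper, with the spectral-gap consequence of non-amenability of Γ₀ and weak containment in the regular representation taken as an explicit hypothesis, exactly as used in its proof.) -/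
open Filter

/-- Lemma 2.5(1): if the restriction of an orthogonal representation `π` to (elements of)
a subgroup `Γ₀` has a finite subset `g₁, …, gₙ` witnessing a spectral gap estimate
`‖ξ‖ ≤ ∑ᵢ ‖π(gᵢ)ξ - ξ‖`, then any cocycle `b` for `π` satisfies
`‖b h‖ ≤ 2 ∑ᵢ ‖b (gᵢ)‖` for every `h` in the centralizer of `Γ₀`; in particular the
restriction of `b` to the centralizer of `Γ₀` is bounded. -/
theorem cocycle_bounded_on_centralizer
    {Γ : Type*} [Group Γ] {H : Type*} [NormedAddCommGroup H] [InnerProductSpace ℝ H]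
    (π : Γ →* (H ≃ₗᵢ[ℝ] H)) (b : Γ → H)
    (hb : ∀ g h : Γ, b (g * h) = b g + π g (b h))
    (Γ₀ : Subgroup Γ) (n : ℕ) (g : Fin n → Γ) (hgΓ₀ : ∀ i, g i ∈ Γ₀)
    (hgap : ∀ ξ : H, ‖ξ‖ ≤ ∑ i, ‖π (g i) ξ - ξ‖) :
    (∀ h ∈ Subgroup.centralizer (Γ₀ : Set Γ), ‖b h‖ ≤ 2 * ∑ i, ‖b (g i)‖) ∧
      (∃ C : ℝ, ∀ h ∈ Subgroup.centralizer (Γ₀ : Set Γ), ‖b h‖ ≤ C) := by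
  have hbound : ∀ h ∈ Subgroup.centralizer (Γ₀ : Set Γ), ‖b h‖ ≤ 2 * ∑ i, ‖b (g i)‖ := by
    intro h hh
    refine (hgap (b h)).trans ?_
    rw [Finset.mul_sum]
    refine Finset.sum_le_sum fun i _ => ?_
    have hcomm : g i * h = h * g i := Subgroup.mem_centralizer_iff.mp hh (g i) (hgΓ₀ i)
    have hcoc : b (g i) + π (g i) (b h) = b h + π h (b (g i)) := by
      rw [← hb, ← hb, hcomm]
    have hdiff : π (g i) (b h) - b h = π h (b (g i)) - b (g i) := by
      rw [sub_eq_sub_iff_add_eq_add, add_comm, hcoc, add_comm]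
    calc ‖π (g i) (b h) - b h‖ = ‖π h (b (g i)) - b (g i)‖ := by rw [hdiff]
      _ ≤ ‖π h (b (g i))‖ + ‖b (g i)‖ := norm_sub_le _ _
      _ = 2 * ‖b (g i)‖ := by rw [LinearIsometryEquiv.norm_map, two_mul]
  exact ⟨hbound, _, hbound⟩
end

section
/- Let Λ be a group and 𝒢 a family of subgroups of Λ. Let I be the collection of subsets of Λ that are small relative to 𝒢, ordered by inclusion, and let ω be a cofinal ultrafilter on I. Suppose that for every S ∈ I an element g_S ∈ Λ ∖ S is given. Then for every W ∈ ω, the subgroup of Λ generated by {g_S · g_{S'}⁻¹ : S, S' ∈ W} does not belong to 𝒢. (This is the final claim in the proof of Theorem 3.1.) -/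
/-- A subset `S` of a group `Λ` is *small relative to* a family `𝒢` of subgroups of `Λ`
if `S ⊆ ⋃ᵢ gᵢ·Λᵢ·hᵢ` for finitely many `gᵢ, hᵢ ∈ Λ` and `Λᵢ ∈ 𝒢`. -/
def IsSmallRel {Λ : Type*} [Group Λ] (𝒢 : Set (Subgroup Λ)) (S : Set Λ) : Prop :=
  ∃ (m : ℕ) (g h : Fin m → Λ) (K : Fin m → Subgroup Λ),
    (∀ i, K i ∈ 𝒢) ∧ S ⊆ ⋃ i, (fun x => g i * x * h i) '' (K i : Set Λ)

/-- The final claim in the proof of Theorem 3.1: let `I` be the collection of subsets of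
`Λ` small relative to `𝒢`, `ω` a cofinal ultrafilter on `I`, and `g_S ∈ Λ ∖ S` for each
`S ∈ I`. Then for every `W ∈ ω` the subgroup generated by
`{g_S · g_{S'}⁻¹ : S, S' ∈ W}` is not in `𝒢`. -/
theorem generated_subgroup_not_small
    {Λ : Type*} [Group Λ] (𝒢 : Set (Subgroup Λ))
    (ω : Ultrafilter {S : Set Λ // IsSmallRel 𝒢 S})
    (hcof : ∀ S₀ : {S : Set Λ // IsSmallRel 𝒢 S},
      {S : {S : Set Λ // IsSmallRel 𝒢 S} | S₀.1 ⊆ S.1} ∈ ω)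
    (g : {S : Set Λ // IsSmallRel 𝒢 S} → Λ)
    (hg : ∀ S, g S ∉ S.1)
    (W : Set {S : Set Λ // IsSmallRel 𝒢 S}) (hW : W ∈ ω) :
    Subgroup.closure {x : Λ | ∃ S ∈ W, ∃ S' ∈ W, x = g S * (g S')⁻¹} ∉ 𝒢 := by
  intro hK
  obtain ⟨T, hT⟩ := ω.nonempty_of_mem hW
  set K := Subgroup.closure {x : Λ | ∃ S ∈ W, ∃ S' ∈ W, x = g S * (g S')⁻¹}
  let coset : {S : Set Λ // IsSmallRel 𝒢 S} :=
    ⟨(fun x => 1 * x * g T) '' (K : Set Λ), 1, fun _ => 1, fun _ => g T, fun _ => K,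
      fun _ => hK, Set.subset_iUnion_of_subset 0 subset_rfl⟩
  obtain ⟨S, hS, hSW⟩ := ω.nonempty_of_mem (Filter.inter_mem (hcof coset) hW)
  exact hg S (hS ⟨g S * (g T)⁻¹, Subgroup.subset_closure ⟨S, hSW, T, hT, rfl⟩, by simp⟩)
end

section
/- Let Λ be a group, I a nonempty set, ω an ultrafilter on I, and g : I → Λ a function. For h ∈ Λ the following are equivalent: (a) there exists k ∈ Λ such that {S ∈ I : h·g(S) = g(S)·k} ∈ ω; (b) there exists T ∈ ω such that h commutes with g(S)·g(S')⁻¹ for all S, S' ∈ T, i.e. h centralizes the subgroup Λ_T generated by {g(S)·g(S')⁻¹ : S, S' ∈ T}. (This is the characterization of the subgroup Σ = Λ ∩ gΛ^ω g⁻¹ used in the proof of Theorem 3.1.) -/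
/-- The characterization of the subgroup `Σ = Λ ∩ g Λ^ω g⁻¹` used in the proof of
Theorem 3.1: for `h ∈ Λ`, there exists `k ∈ Λ` with `h·g(S) = g(S)·k` for `ω`-almost
every `S` if and only if there exists `T ∈ ω` such that `h` commutes with
`g(S)·g(S')⁻¹` for all `S, S' ∈ T`. -/
theorem mem_ultraproduct_conj_iff_commutes
    {Λ : Type*} [Group Λ] {I : Type*} [Nonempty I]
    (ω : Ultrafilter I) (g : I → Λ) (h : Λ) :
    (∃ k : Λ, {S : I | h * g S = g S * k} ∈ ω) ↔
      (∃ T ∈ ω, ∀ S ∈ T, ∀ S' ∈ T, Commute h (g S * (g S')⁻¹)) := by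
  constructor
  · rintro ⟨k, hk⟩
    refine ⟨_, hk, fun S hS S' hS' => ?_⟩
    have hS : h * g S = g S * k := hS
    have hS' : h * g S' = g S' * k := hS'
    calc h * (g S * (g S')⁻¹) = g S * (g S')⁻¹ * (g S' * k) * (g S')⁻¹ := by
          rw [← mul_assoc, hS]; group
      _ = g S * (g S')⁻¹ * h := by rw [← hS']; group
  · rintro ⟨T, hT, hcomm⟩
    obtain ⟨S₀, hS₀⟩ := ω.nonempty_of_mem hT
    refine ⟨(g S₀)⁻¹ * h * g S₀, Filter.mem_of_superset hT fun S hS => ?_⟩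
    calc h * g S = h * (g S * (g S₀)⁻¹) * g S₀ := by group
      _ = g S * ((g S₀)⁻¹ * h * g S₀) := by rw [(hcomm S hS S₀ hS₀).eq]; group
end

section
/- Let Λ be a countable group, I a nonempty set, ω an ultrafilter on I, and g : I → Λ a function. Define Σ = {h ∈ Λ : there exists k ∈ Λ with {S ∈ I : h·g(S) = g(S)·k} ∈ ω}. Then there exists a decreasing sequence W₁ ⊇ W₂ ⊇ ⋯ of sets in ω such that Σ = ⋃_{n ≥ 1} C(Λ_{Wₙ}), where Λ_W denotes the subgroup of Λ generated by {g(S)·g(S')⁻¹ : S, S' ∈ W} and C(Λ_W) denotes its centralizer in Λ. (This is the decomposition of Σ as an increasing union of centralizers established in the proof of Theorem 3.1.) -/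
/-- For nonempty `W`, an element centralizes the subgroup generated by the quotients
`g S * (g S')⁻¹` iff its conjugates by the `(g S)⁻¹` all agree on `W`. -/
theorem mem_centralizer_closure_quotients_iff {G I : Type*} [Group G] (g : I → G) {W : Set I}
    (hW : W.Nonempty) (h : G) :
    h ∈ Subgroup.centralizer
        ((Subgroup.closure {x : G | ∃ S ∈ W, ∃ S' ∈ W, x = g S * (g S')⁻¹} : Subgroup G) :
          Set G) ↔
      ∃ k, ∀ S ∈ W, h * g S = g S * k := by
  rw [Subgroup.centralizer_closure, Subgroup.mem_centralizer_iff]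
  constructor
  · intro hh
    obtain ⟨T, hT⟩ := hW
    refine ⟨(g T)⁻¹ * h * g T, fun S hS => ?_⟩
    have hST := hh _ ⟨S, hS, T, hT, rfl⟩
    calc h * g S = h * (g S * (g T)⁻¹) * g T := by group
      _ = g S * ((g T)⁻¹ * h * g T) := by rw [← hST]; group
  · rintro ⟨k, hk⟩ _ ⟨S, hS, T, hT, rfl⟩
    have hT' : (g T)⁻¹ * h = k * (g T)⁻¹ := by
      rw [inv_mul_eq_iff_eq_mul, ← mul_assoc, ← hk T hT, mul_inv_cancel_right]
    rw [mul_assoc, hT', ← mul_assoc, ← hk S hS, mul_assoc]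

/-- The decomposition of `Σ` as an increasing union of centralizers established in the
proof of Theorem 3.1: for a countable group `Λ`, an ultrafilter `ω` on `I` and
`g : I → Λ`, there is a decreasing sequence `W₁ ⊇ W₂ ⊇ ⋯` of sets in `ω` such that
`Σ = ⋃ₙ C(Λ_{Wₙ})`, where `Σ` consists of those `h` for which `h·g(S)·h⁻¹` is
`ω`-a.e. equal to a fixed element of `Λ` times `g(S)` on the right, `Λ_W` is the
subgroup generated by `{g(S)·g(S')⁻¹ : S, S' ∈ W}` and `C(·)` is the centralizer. -/
theorem sigma_eq_union_centralizers
    {Λ : Type*} [Group Λ] [Countable Λ] {I : Type*} [Nonempty I]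
    (ω : Ultrafilter I) (g : I → Λ) :
    ∃ W : ℕ → Set I, (∀ n, W n ∈ ω) ∧ (∀ n, W (n + 1) ⊆ W n) ∧
      ∀ h : Λ, (∃ k : Λ, {S : I | h * g S = g S * k} ∈ ω) ↔
        ∃ n, h ∈ Subgroup.centralizer
          ((Subgroup.closure {x : Λ | ∃ S ∈ W n, ∃ S' ∈ W n, x = g S * (g S')⁻¹} : Subgroup Λ) :
            Set Λ) := by
  obtain ⟨e, he⟩ := exists_surjective_nat Λ
  have hV (h : Λ) : ∃ V ∈ ω, (∃ k : Λ, {S : I | h * g S = g S * k} ∈ ω) →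
      ∃ k, ∀ S ∈ V, h * g S = g S * k := by
    by_cases hk : ∃ k : Λ, {S : I | h * g S = g S * k} ∈ ω
    · obtain ⟨k, hk⟩ := hk
      exact ⟨_, hk, fun _ => ⟨k, fun _ hS => hS⟩⟩
    · exact ⟨Set.univ, Filter.univ_mem, fun hk' => absurd hk' hk⟩
  choose V hVω hVk using hV
  let W (n : ℕ) : Set I := ⋂ i ∈ Set.Iic n, V (e i)
  have hW (n : ℕ) : W n ∈ ω :=
    (Filter.biInter_mem (Set.finite_Iic n)).2 fun i _ => hVω (e i)
  refine ⟨W, hW, fun n => Set.biInter_subset_biInter_left (Set.Iic_subset_Iic.2 n.le_succ), ?_⟩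
  intro h
  simp only [fun n => mem_centralizer_closure_quotients_iff g (ω.nonempty_of_mem (hW n)) h]
  constructor
  · intro hh
    obtain ⟨n, rfl⟩ := he h
    obtain ⟨k, hk⟩ := hVk _ hh
    exact ⟨n, k, fun S hS => hk S (Set.mem_iInter₂.1 hS n Set.self_mem_Iic)⟩
  · rintro ⟨n, k, hk⟩
    exact ⟨k, Filter.mem_of_superset (hW n) hk⟩
end
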